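/- Let (S;∧,∨,→,1) be a skew Heyting algebra and let x, y, z ∈ S. Then (x∨y∨x)→z = (x→z)∧(y→z)∧(x→z). -/

import Mathlib

/-- A skew lattice: both operations idempotent, associative, with the four absorption laws. -/
structure SkewLattice (S : Type*) where
  m : S → S → S  -- meet ∧
  j : S → S → S  -- join ∨
  m_idem : ∀ x, m x x = x
  j_idem : ∀ x, j x x = x
  m_assoc : ∀ x y z, m (m x y) z = m x (m y z)
  j_assoc : ∀ x y z, j (j x y) z = j x (j y z)
  abs1 : ∀ x y, m x (j x y) = x
  abs2 : ∀ x y, j x (m x y) = x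
  abs3 : ∀ x y, j (m x y) y = y
  abs4 : ∀ x y, m (j x y) y = y

namespace SkewLattice

variable {S : Type*}

/-- Natural partial order: x ≤ y iff x∨y = y = y∨x. -/
def nle (L : SkewLattice S) (x y : S) : Prop := L.j x y = y ∧ L.j y x = y

/-- Natural preorder: x ⪯ y iff y∨x∨y = y. -/
def npre (L : SkewLattice S) (x y : S) : Prop := L.j (L.j y x) y = y

/-- Green's relation D: x D y iff x ⪯ y and y ⪯ x. -/
def dRel (L : SkewLattice S) (x y : S) : Prop := L.npre x y ∧ L.npre y x

/-- Green's relation L. -/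
def lRel (L : SkewLattice S) (x y : S) : Prop := L.m x y = x ∧ L.m y x = y

/-- Green's relation R. -/
def rRel (L : SkewLattice S) (x y : S) : Prop := L.m x y = y ∧ L.m y x = x

/-- Co-strong distributivity. -/
def CoStronglyDistributive (L : SkewLattice S) : Prop :=
  (∀ x y z, L.j x (L.m y z) = L.m (L.j x y) (L.j x z)) ∧
  (∀ x y z, L.j (L.m x y) z = L.m (L.j x z) (L.j y z))

/-- Conormality: x∨y∨z∨w = x∨z∨y∨w. -/
def Conormal (L : SkewLattice S) : Prop :=
  ∀ x y z w, L.j (L.j (L.j x y) z) w = L.j (L.j (L.j x z) y) w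

/-- t is a top: x∨t = t = t∨x for all x. -/
def IsTop (L : SkewLattice S) (t : S) : Prop := ∀ x, L.j x t = t ∧ L.j t x = t

/-- `h` is a skew Heyting implication for the skew lattice `L`:
(i) x→y = (y∨x∨y)→y, and (ii) whenever y ≤ x, x→y is the greatest element w
of the upset y↑ satisfying w∧x ≤ y. -/
def IsSkewHeytingImp (L : SkewLattice S) (h : S → S → S) : Prop :=
  (∀ x y, h x y = h (L.j (L.j y x) y) y) ∧
  (∀ x y, L.nle y x →
     L.nle y (h x y) ∧ L.nle (L.m (h x y) x) y ∧
     ∀ w, L.nle y w → L.nle (L.m w x) y → L.nle w (h x y))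

end SkewLattice

open SkewLattice

/-- A skew Heyting algebra: a co-strongly distributive skew lattice with top 1 together
with an implication satisfying (i) and (ii) above. -/
structure SkewHeytingAlgebra (S : Type*) extends SkewLattice S where
  himp : S → S → S
  one : S
  costrong : toSkewLattice.CoStronglyDistributive
  top : toSkewLattice.IsTop one
  himp_spec : toSkewLattice.IsSkewHeytingImp himp

namespace SkewLattice

variable {S : Type*} (L : SkewLattice S)

theorem nle_iff_m {x y : S} : L.nle x y ↔ L.m x y = x ∧ L.m y x = x := by
  constructor
  · rintro ⟨h₁, h₂⟩
    exact ⟨by rw [← h₁, L.abs1], by rw [← h₂, L.abs4]⟩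
  · rintro ⟨h₁, h₂⟩
    exact ⟨by rw [← h₁, L.abs3], by rw [← h₂, L.abs2]⟩

theorem nle_antisymm {x y : S} (hxy : L.nle x y) (hyx : L.nle y x) : x = y :=
  hyx.2.symm.trans hxy.1

theorem nle_j {u x y : S} (hx : L.nle u x) (hy : L.nle u y) : L.nle u (L.j x y) :=
  ⟨by rw [← L.j_assoc, hx.1], by rw [L.j_assoc, hy.2]⟩

theorem nle_m {u x y : S} (hx : L.nle u x) (hy : L.nle u y) : L.nle u (L.m x y) := by
  rw [nle_iff_m] at *
  exact ⟨by rw [← L.m_assoc, hx.1, hy.1], by rw [L.m_assoc, hy.2, hx.2]⟩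

theorem nle_j_j (u x : S) : L.nle u (L.j (L.j u x) u) :=
  ⟨by simp only [← L.j_assoc, L.j_idem], by simp only [L.j_assoc, L.j_idem]⟩

/-- In the join band, an element absorbs each of its factors. -/
theorem j_absorb_factor (a x b : S) :
    L.j (L.j (L.j (L.j a x) b) x) (L.j (L.j a x) b) = L.j (L.j a x) b := by
  set s := L.j (L.j a x) b with hs
  have key : L.j (L.j s x) (L.j (L.j x b) s) = s := by
    calc L.j (L.j s x) (L.j (L.j x b) s) = L.j (L.j s (L.j (L.j x x) b)) s := by
          simp only [L.j_assoc]
      _ = L.j (L.j a (L.j (L.j x b) (L.j x b))) s := by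
          rw [L.j_idem, hs]; simp only [L.j_assoc]
      _ = L.j s s := by rw [L.j_idem, hs]; simp only [L.j_assoc]
      _ = s := L.j_idem s
  calc L.j (L.j s x) s = L.j (L.j s x) (L.j (L.j s x) (L.j (L.j x b) s)) := by rw [key]
    _ = L.j (L.j s x) (L.j (L.j x b) s) := by rw [← L.j_assoc (L.j s x) (L.j s x), L.j_idem]
    _ = s := key

/-- In the join band, an element absorbing two elements absorbs their join. -/
theorem j_absorb_j {s x y : S} (hx : L.j (L.j s x) s = s) (hy : L.j (L.j s y) s = s) :
    L.j (L.j s (L.j x y)) s = s := by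
  have e : L.j (L.j (L.j y s) x) s = L.j y s := by
    conv_rhs => rw [← hx]
    simp only [L.j_assoc]
  have h := L.j_absorb_factor (L.j y s) x s
  rw [e] at h
  calc L.j (L.j s (L.j x y)) s = L.j (L.j (L.j (L.j s y) s) x) (L.j y s) := by
        rw [hy]; simp only [L.j_assoc]
    _ = L.j s (L.j (L.j (L.j y s) x) (L.j y s)) := by simp only [L.j_assoc]
    _ = s := by rw [h, ← L.j_assoc, hy]

variable {L}

namespace CoStronglyDistributive

variable (hL : L.CoStronglyDistributive) {u a b : S}
include hL

theorem m_j_left (ha : L.nle u a) (hb : L.nle u b) : L.m a (L.j b a) = a := by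
  have h := hL.2 u b a
  rwa [((L.nle_iff_m).1 hb).1, ha.1, eq_comm] at h

theorem j_m_right (ha : L.nle u a) (hb : L.nle u b) : L.m (L.j a b) a = a := by
  have h := hL.1 a b u
  rwa [((L.nle_iff_m).1 hb).2, ha.2, eq_comm] at h

theorem m_j_m_j (x y z w : S) :
    L.m (L.m (L.j x z) (L.j y z)) (L.m (L.j x w) (L.j y w)) =
      L.m (L.m (L.j x z) (L.j x w)) (L.m (L.j y z) (L.j y w)) := by
  rw [← hL.2, ← hL.2, ← hL.1, ← hL.1, ← hL.1, hL.2]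

/-- Meets commute in principal upsets. -/
theorem m_comm (ha : L.nle u a) (hb : L.nle u b) : L.m a b = L.m b a := by
  have h₁ : L.m a b = L.m b (L.m a b) := by
    have h := hL.m_j_m_j b u a b
    rwa [ha.1, hb.1, L.j_idem, L.m_idem, L.abs4, hL.j_m_right hb ha] at h
  have h₂ : L.m b a = L.m b (L.m a b) := by
    have h := hL.m_j_m_j u b b a
    rwa [ha.1, hb.1, L.j_idem, L.m_idem, hL.m_j_left ha hb, L.abs1, L.m_assoc] at h
  rw [h₁, h₂]

/-- Joins commute in principal upsets. -/
theorem j_comm (ha : L.nle u a) (hb : L.nle u b) : L.j a b = L.j b a := by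
  have h₁ : L.nle a (L.j b a) := L.nle_iff_m.2 ⟨hL.m_j_left ha hb, L.abs4 b a⟩
  have h₂ : L.nle a (L.j a b) := L.nle_iff_m.2 ⟨L.abs1 a b, hL.j_m_right ha hb⟩
  rw [← h₂.2, ← h₁.1, L.j_assoc]

theorem m_j_of_m_eq {w : S} (hb : L.nle u b)
    (hwa : L.m w a = u) (hwb : L.m w b = u) : L.m w (L.j a b) = u := by
  have h : L.m (L.j w b) (L.j a b) = b := by rw [← hL.2, hwa, hb.1]
  have h' : L.m w (L.j w b) = w := L.abs1 w b
  rw [← hwb, ← h', L.m_assoc, h, h']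

/-- Closing up in a principal upset turns `x ∨ y ∨ x` into a join. -/
theorem j_j_closure (x y z : S) :
    L.j (L.j z (L.j (L.j x y) x)) z =
      L.j (L.j (L.j z x) z) (L.j (L.j z y) z) := by
  set c := L.j (L.j z (L.j (L.j x y) x)) z with hc
  set p := L.j (L.j z x) z with hp
  set q := L.j (L.j z y) z with hq
  have hzc : L.nle z c := L.nle_j_j z _
  have hzp : L.nle z p := L.nle_j_j z x
  have hzq : L.nle z q := L.nle_j_j z y
  have absorb {s t : S} (hs : L.nle z s) (h : L.j (L.j s t) s = s) :
      L.j s (L.j (L.j z t) z) = s := by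
    have e : L.j (L.j s (L.j (L.j z t) z)) s = s := by
      calc _ = L.j (L.j (L.j s z) t) (L.j z s) := by simp only [L.j_assoc]
        _ = s := by rw [hs.1, hs.2, h]
    rwa [L.j_assoc, hL.j_comm (L.nle_j_j z t) hs, ← L.j_assoc, L.j_idem] at e
  have hcp : L.j c p = c := absorb hzc (by
    have h := L.j_absorb_factor z x (L.j (L.j y x) z)
    have e : L.j (L.j z x) (L.j (L.j y x) z) = c := by rw [hc]; simp only [L.j_assoc]
    rwa [e] at h)
  have hcq : L.j c q = c := absorb hzc (by
    have h := L.j_absorb_factor (L.j z x) y (L.j x z)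
    have e : L.j (L.j (L.j z x) y) (L.j x z) = c := by rw [hc]; simp only [L.j_assoc]
    rwa [e] at h)
  have hsc : L.j (L.j p q) c = L.j p q := by
    have hx : L.j (L.j (L.j p q) x) (L.j p q) = L.j p q := by
      have h := L.j_absorb_factor z x (L.j z q)
      have e : L.j (L.j z x) (L.j z q) = L.j p q := by rw [hp]; simp only [L.j_assoc]
      rwa [e] at h
    have hy : L.j (L.j (L.j p q) y) (L.j p q) = L.j p q := by
      have h := L.j_absorb_factor (L.j p z) y z
      have e : L.j (L.j (L.j p z) y) z = L.j p q := by rw [hq]; simp only [L.j_assoc]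
      rwa [e] at h
    exact absorb (L.nle_j hzp hzq) (L.j_absorb_j (L.j_absorb_j hx hy) hx)
  rw [← hsc, ← hL.j_comm hzc (L.nle_j hzp hzq), ← L.j_assoc, hcp, hcq]

end CoStronglyDistributive

namespace IsSkewHeytingImp

variable {h : S → S → S} (hh : L.IsSkewHeytingImp h) {u a b : S}
include hh

theorem m_eq (ha : L.nle u a) : L.m (h a u) a = u :=
  have ⟨h₁, h₂, _⟩ := hh.2 a u ha
  L.nle_antisymm h₂ (L.nle_m h₁ ha)

theorem nle_of_m_eq {w : S} (ha : L.nle u a) (hw : L.nle u w) (hwa : L.m w a = u) :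
    L.nle w (h a u) :=
  (hh.2 a u ha).2.2 w hw (by rw [hwa]; exact ⟨L.j_idem u, L.j_idem u⟩)

/-- In a principal upset, implication turns joins into meets. -/
theorem imp_j (hL : L.CoStronglyDistributive) (ha : L.nle u a) (hb : L.nle u b) :
    h (L.j a b) u = L.m (h a u) (h b u) := by
  have hab := L.nle_j ha hb
  have hk := (hh.2 _ u hab).1
  have hp := (hh.2 a u ha).1
  have hq := (hh.2 b u hb).1
  have hkab := hh.m_eq hab
  have hkp : L.nle (h (L.j a b) u) (h a u) := hh.nle_of_m_eq ha hk (by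
    have e := L.m_assoc (h (L.j a b) u) (L.j a b) a
    rwa [hL.j_m_right ha hb, hkab, (L.nle_iff_m.1 ha).1, eq_comm] at e)
  have hkq : L.nle (h (L.j a b) u) (h b u) := hh.nle_of_m_eq hb hk (by
    have e := L.m_assoc (h (L.j a b) u) (L.j a b) b
    rwa [L.abs4, hkab, (L.nle_iff_m.1 hb).1, eq_comm] at e)
  have hpq := L.nle_m hp hq
  refine L.nle_antisymm (L.nle_m hkp hkq)
    (hh.nle_of_m_eq hab hpq (hL.m_j_of_m_eq hb ?_ ?_))
  · rw [hL.m_comm hp hq, L.m_assoc, hh.m_eq ha, (L.nle_iff_m.1 hq).2]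
  · rw [L.m_assoc, hh.m_eq hb, (L.nle_iff_m.1 hp).2]

end IsSkewHeytingImp

end SkewLattice

/-- in a skew Heyting algebra,
(x∨y∨x)→z = (x→z)∧(y→z)∧(x→z). -/
theorem stmt_19 {S : Type*} (A : SkewHeytingAlgebra S) (x y z : S) :
    A.himp (A.j (A.j x y) x) z =
      A.m (A.m (A.himp x z) (A.himp y z)) (A.himp x z) := by
  have hL := A.costrong
  have hh := A.himp_spec
  have hx := A.nle_j_j z x
  have hy := A.nle_j_j z y
  rw [hh.1 (A.j (A.j x y) x) z, hh.1 x z, hh.1 y z, hL.j_j_closure, hh.imp_j hL hx hy,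
    hL.m_comm (hh.2 _ z hx).1 (hh.2 _ z hy).1, A.m_assoc, A.m_idem]
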